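/- Assume c₀, c₁, c_e > 0, fix U ≥ 0, and let g(U) be the unique real solution g of c₀ = √(κ/(U+κ)) · exp(g/(2σ²(U+κ)) − μ_x²κ/(2σ²)) · (c₁ + c_e·g/(U+κ)²). If g(U) > 0, then the set of V ∈ ℝ for which c₀ − ℓ(U,V) ≤ 0 is exactly (−∞, −V₁(U)] ∪ [V₂(U), ∞), where V₁(U) = √(g(U)) + μ_x·κ and V₂(U) = √(g(U)) − μ_x·κ; moreover c₀ = ℓ(U, −V₁(U)) = ℓ(U, V₂(U)). -/

import Mathlib

open Real

/-- κ = σ²/σx² -/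
noncomputable def kap (σ σx : ℝ) : ℝ := σ ^ 2 / σx ^ 2

/-- The marginalized likelihood ratio L(U,V). -/
noncomputable def Lf (σ σx μx U V : ℝ) : ℝ :=
  σ / σx / Real.sqrt (U + kap σ σx) *
    Real.exp ((V + μx * kap σ σx) ^ 2 / (2 * σ ^ 2 * (U + kap σ σx)) - μx ^ 2 / (2 * σx ^ 2))

/-- The optimum estimate m(U,V). -/
noncomputable def mf (σ σx μx U V : ℝ) : ℝ :=
  (V + μx * kap σ σx) / (U + kap σ σx)

/-- ℓ(U,V) = L(U,V)(c₁ + c_e m(U,V)²). -/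
noncomputable def ellf (σ σx μx c₁ ce U V : ℝ) : ℝ :=
  Lf σ σx μx U V * (c₁ + ce * (mf σ σx μx U V) ^ 2)

/-- The right-hand side of the threshold equation (3.1), as a function of g. -/
noncomputable def Ff (σ σx μx c₁ ce U g : ℝ) : ℝ :=
  Real.sqrt (kap σ σx / (U + kap σ σx)) *
    Real.exp (g / (2 * σ ^ 2 * (U + kap σ σx)) - μx ^ 2 * kap σ σx / (2 * σ ^ 2)) *
    (c₁ + ce * g / (U + kap σ σx) ^ 2)

lemma kap_pos {σ σx : ℝ} (hσ : 0 < σ) (hσx : 0 < σx) : 0 < kap σ σx := by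
  unfold kap
  positivity

/-- The loss `ℓ(U, V)` depends on `V` only through `(V + μx κ)²`. -/
lemma ellf_eq_Ff {σ σx : ℝ} (hσ : 0 < σ) (hσx : 0 < σx) (μx c₁ ce U V : ℝ) :
    ellf σ σx μx c₁ ce U V = Ff σ σx μx c₁ ce U ((V + μx * kap σ σx) ^ 2) := by
  have hsqrt : Real.sqrt (kap σ σx) = σ / σx := by
    rw [kap, ← div_pow, Real.sqrt_sq (by positivity)]
  have hexp : μx ^ 2 * kap σ σx / (2 * σ ^ 2) = μx ^ 2 / (2 * σx ^ 2) := by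
    unfold kap
    field_simp
  rw [ellf, Lf, mf, Ff, Real.sqrt_div (kap_pos hσ hσx).le, hsqrt, hexp, div_pow, mul_div_assoc ce]

lemma Ff_strictMonoOn {σ σx c₁ ce U : ℝ} (hσ : 0 < σ) (hσx : 0 < σx) (hc₁ : 0 < c₁)
    (hce : 0 < ce) (hU : 0 ≤ U) (μx : ℝ) :
    StrictMonoOn (Ff σ σx μx c₁ ce U) (Set.Ici 0) := by
  intro a ha b hb hab
  have hκ := kap_pos hσ hσx
  have ha' : 0 ≤ a := ha
  have hden : 0 < U + kap σ σx := by positivity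
  have hs : 0 < Real.sqrt (kap σ σx / (U + kap σ σx)) := Real.sqrt_pos.2 (by positivity)
  unfold Ff
  gcongr

/-- if g = g(U) > 0 solves the threshold equation, then
{V : c₀ − ℓ(U,V) ≤ 0} = (−∞, −V₁(U)] ∪ [V₂(U), ∞) with
V₁(U) = √g + μxκ, V₂(U) = √g − μxκ, and c₀ = ℓ(U,−V₁(U)) = ℓ(U,V₂(U)). -/
theorem stopping_region_characterization (σ σx μx c₀ c₁ ce : ℝ)
    (hσ : 0 < σ) (hσx : 0 < σx) (hc₀ : 0 < c₀) (hc₁ : 0 < c₁) (hce : 0 < ce)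
    (U g : ℝ) (hU : 0 ≤ U) (hsol : c₀ = Ff σ σx μx c₁ ce U g) (hgpos : 0 < g) :
    {V : ℝ | c₀ - ellf σ σx μx c₁ ce U V ≤ 0} =
      Set.Iic (-(Real.sqrt g + μx * kap σ σx)) ∪
        Set.Ici (Real.sqrt g - μx * kap σ σx) ∧
    c₀ = ellf σ σx μx c₁ ce U (-(Real.sqrt g + μx * kap σ σx)) ∧
    c₀ = ellf σ σx μx c₁ ce U (Real.sqrt g - μx * kap σ σx) := by
  have hell := ellf_eq_Ff hσ hσx μx c₁ ce U
  have hsq : Real.sqrt g ^ 2 = g := Real.sq_sqrt hgpos.le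
  refine ⟨?_, ?_, ?_⟩
  · ext V
    rw [Set.mem_ofPred_eq, sub_nonpos, hsol, hell,
      (Ff_strictMonoOn hσ hσx hc₁ hce hU μx).le_iff_le hgpos.le (Set.mem_Ici.2 (sq_nonneg _)),
      ← Real.sqrt_le_sqrt_iff (sq_nonneg _), Real.sqrt_sq_eq_abs, le_abs', Set.mem_union,
      Set.mem_Iic, Set.mem_Ici, neg_add, ← sub_eq_add_neg, le_sub_iff_add_le,
      sub_le_iff_le_add]
  · rw [hell, hsol]
    congr 1
    linear_combination -hsq
  · rw [hell, hsol]
    congr 1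
    linear_combination -hsq
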